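/- (Full conditional of the auxiliary indicator γ_i in the Gibbs sampler.) Let m ≥ 1, M > 0, α ∈ (0,1), let ρ_prev and λ be partitions of {1, …, m}, let γ ∈ {0,1}^m, and fix i ∈ {1, …, m}. Define the joint weight f(γ, λ) = (∏_{j=1}^m α^{γ_j}(1 − α)^{1 − γ_j}) · I[λ|_{S(γ)} = ρ_prev|_{S(γ)}] · p_m(λ) / p_{|S(γ)|}(λ|_{S(γ)}), where S(γ) = {j : γ_j = 1}. Let S⁻ = {j ≠ i : γ_j = 1}, and let γ^{(i←1)} and γ^{(i←0)} denote γ with its i-th coordinate set to 1 and to 0, respectively. If λ|_{S⁻ ∪ {i}} = ρ_prev|_{S⁻ ∪ {i}}, then f(γ^{(i←1)}, λ) / ( f(γ^{(i←1)}, λ) + f(γ^{(i←0)}, λ) ) = α · p_{|S⁻|}(λ|_{S⁻}) / ( α · p_{|S⁻|}(λ|_{S⁻}) + (1 − α) · p_{|S⁻|+1}(λ|_{S⁻ ∪ {i}}) ). -/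

import Mathlib

open Finset

noncomputable section

/-- CRP(M) probability of a partition of a finite set `s` of `n = s.card` elements:
`p_n(ρ) = M^k ∏_j (|S_j| - 1)! / ∏_{i=1}^n (M + i - 1)`. -/
def crp {α : Type*} [DecidableEq α] (M : ℝ) {s : Finset α} (P : Finpartition s) : ℝ :=
  (M ^ P.parts.card * ∏ b ∈ P.parts, (Nat.factorial (b.card - 1) : ℝ)) /
    ∏ i ∈ Finset.range s.card, (M + i)

/-- Restriction of a partition of `s` to a subset `A ⊆ s`: the clusters are the
nonempty intersections of the clusters with `A`. -/
def restrictPart {α : Type*} [DecidableEq α] {s : Finset α} (P : Finpartition s)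
    (A : Finset α) (hA : A ⊆ s) : Finpartition A :=
  Finpartition.ofErase (P.parts.image (· ∩ A))
    (by
      rw [Finset.supIndep_iff_pairwiseDisjoint]
      rintro x hx y hy hxy
      simp only [coe_image, Set.mem_image, mem_coe] at hx hy
      obtain ⟨p, hp, rfl⟩ := hx
      obtain ⟨q, hq, rfl⟩ := hy
      have hpq : p ≠ q := by rintro rfl; exact hxy rfl
      exact (P.disjoint hp hq hpq).mono inter_subset_left inter_subset_left)
    (by
      rw [Finset.sup_image]
      have : (P.parts.sup (id ∘ (· ∩ A))) = P.parts.sup id ⊓ A := by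
        rw [Finset.sup_inf_distrib_right]
        rfl
      rw [this, P.sup_parts]
      exact inf_eq_right.mpr hA)

/-- The set `S(γ) = {i : γ i = 1}`. -/
def gammaSet {m : ℕ} (γ : Fin m → Bool) : Finset (Fin m) :=
  Finset.univ.filter (fun i => γ i = true)

/-- The one-step tRPM transition kernel `K_α(ρ, λ)`. -/
def tK {m : ℕ} (M a : ℝ) (ρ lam : Finpartition (Finset.univ : Finset (Fin m))) : ℝ :=
  ∑ γ : Fin m → Bool,
    (∏ i, if γ i then a else 1 - a) *
      (if restrictPart lam (gammaSet γ) (Finset.subset_univ _) =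
          restrictPart ρ (gammaSet γ) (Finset.subset_univ _) then 1 else 0) *
      (crp M lam / crp M (restrictPart lam (gammaSet γ) (Finset.subset_univ _)))

end

theorem mem_restrictPart {α : Type*} [DecidableEq α] {s : Finset α} (P : Finpartition s)
    (A : Finset α) (hA : A ⊆ s) (x : Finset α) :
    x ∈ (restrictPart P A hA).parts ↔ x ≠ ∅ ∧ ∃ p ∈ P.parts, p ∩ A = x := by
  simp [restrictPart, Finpartition.ofErase]

theorem restrictPart_trans {α : Type*} [DecidableEq α] {s : Finset α} (P : Finpartition s)
    (A B : Finset α) (hA : A ⊆ s) (hB : B ⊆ s) (hAB : A ⊆ B) :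
    restrictPart (restrictPart P B hB) A hAB = restrictPart P A hA := by
  apply Finpartition.ext
  ext x
  rw [mem_restrictPart, mem_restrictPart]
  refine and_congr_right fun hx => ?_
  constructor
  · rintro ⟨p, hp, rfl⟩
    obtain ⟨-, q, hq, rfl⟩ := (mem_restrictPart _ _ _ _).1 hp
    exact ⟨q, hq, by rw [Finset.inter_assoc, Finset.inter_eq_right.2 hAB]⟩
  · rintro ⟨q, hq, rfl⟩
    have h : q ∩ B ∩ A = q ∩ A := by rw [Finset.inter_assoc, Finset.inter_eq_right.2 hAB]
    refine ⟨q ∩ B, (mem_restrictPart _ _ _ _).2 ⟨?_, q, hq, rfl⟩, h⟩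
    intro h0
    rw [h0] at h
    exact hx (by rw [← h]; simp)

theorem crp_pos {α : Type*} [DecidableEq α] {M : ℝ} (hM : 0 < M) {s : Finset α}
    (P : Finpartition s) : 0 < crp M P := by
  unfold crp
  have h1 : 0 < ∏ b ∈ P.parts, (Nat.factorial (b.card - 1) : ℝ) :=
    Finset.prod_pos fun b _ => by positivity
  have h2 : 0 < ∏ i ∈ Finset.range s.card, (M + i) :=
    Finset.prod_pos fun b _ => by positivity
  positivity

theorem prod_update_weight {m : ℕ} (a : ℝ) (γ : Fin m → Bool) (i : Fin m) (b : Bool) :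
    (∏ j, if Function.update γ i b j then a else 1 - a) =
      (if b then a else 1 - a) * ∏ j ∈ Finset.univ.erase i, if γ j then a else 1 - a := by
  rw [← Finset.mul_prod_erase _ _ (Finset.mem_univ i), Function.update_self]
  congr 1
  refine Finset.prod_congr rfl fun j hj => ?_
  rw [Function.update_of_ne (Finset.ne_of_mem_erase hj)]

/-- full conditional of the auxiliary indicator `γ_i`: with
`f(γ, λ) = (∏_j α^{γ_j}(1-α)^{1-γ_j}) · I[λ|_{S(γ)} = ρprev|_{S(γ)}] · p_m(λ) / p(λ|_{S(γ)})`,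
`S⁻ = {j ≠ i : γ_j = 1}`, and `λ|_{S⁻ ∪ {i}} = ρprev|_{S⁻ ∪ {i}}`, the Gibbs full
conditional probability that `γ_i = 1` equals
`α p(λ|_{S⁻}) / (α p(λ|_{S⁻}) + (1-α) p(λ|_{S⁻ ∪ {i}}))`. -/
theorem statement9 (m : ℕ) (hm : 1 ≤ m) (M : ℝ) (hM : 0 < M)
    (a : ℝ) (ha : a ∈ Set.Ioo (0 : ℝ) 1)
    (ρprev lam : Finpartition (Finset.univ : Finset (Fin m)))
    (γ : Fin m → Bool) (i : Fin m)
    (f : (Fin m → Bool) → ℝ)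
    (hf : ∀ γ' : Fin m → Bool, f γ' =
      (∏ j, if γ' j then a else 1 - a) *
        (if restrictPart lam (gammaSet γ') (Finset.subset_univ _) =
            restrictPart ρprev (gammaSet γ') (Finset.subset_univ _) then 1 else 0) *
        crp M lam / crp M (restrictPart lam (gammaSet γ') (Finset.subset_univ _)))
    (Sminus : Finset (Fin m))
    (hS : Sminus = Finset.univ.filter (fun j => j ≠ i ∧ γ j = true))
    (hcompat : restrictPart lam (insert i Sminus) (Finset.subset_univ _) =
        restrictPart ρprev (insert i Sminus) (Finset.subset_univ _)) :
    f (Function.update γ i true) /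
        (f (Function.update γ i true) + f (Function.update γ i false)) =
      a * crp M (restrictPart lam Sminus (Finset.subset_univ _)) /
        (a * crp M (restrictPart lam Sminus (Finset.subset_univ _)) +
          (1 - a) * crp M (restrictPart lam (insert i Sminus) (Finset.subset_univ _))) := by
  have key : ∀ (γ' : Fin m → Bool) (S : Finset (Fin m)), gammaSet γ' = S →
      restrictPart lam S (Finset.subset_univ _) = restrictPart ρprev S (Finset.subset_univ _) →
      f γ' = (∏ j, if γ' j then a else 1 - a) * crp M lam /
        crp M (restrictPart lam S (Finset.subset_univ _)) := by
    rintro γ' S rfl h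
    rw [hf, if_pos h, mul_one]
  have hg1 : gammaSet (Function.update γ i true) = insert i Sminus := by
    subst hS
    ext j
    by_cases hj : j = i
    · subst hj; simp [gammaSet]
    · simp [gammaSet, hj]
  have hg0 : gammaSet (Function.update γ i false) = Sminus := by
    subst hS
    ext j
    by_cases hj : j = i
    · subst hj; simp [gammaSet]
    · simp [gammaSet, hj]
  have hsub : Sminus ⊆ insert i Sminus := Finset.subset_insert _ _
  have hcompat0 : restrictPart lam Sminus (Finset.subset_univ _) =
      restrictPart ρprev Sminus (Finset.subset_univ _) := by
    rw [← restrictPart_trans lam _ _ (Finset.subset_univ _) (Finset.subset_univ _) hsub, hcompat,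
      restrictPart_trans]
  rw [key _ _ hg1 hcompat, key _ _ hg0 hcompat0, prod_update_weight, prod_update_weight]
  have hW : 0 < ∏ j ∈ Finset.univ.erase i, if γ j then a else 1 - a :=
    Finset.prod_pos fun j _ => by
      split_ifs
      · exact ha.1
      · linarith [ha.2]
  have hL := crp_pos hM lam
  have hp := crp_pos hM (restrictPart lam Sminus (Finset.subset_univ _))
  have hq := crp_pos hM (restrictPart lam (insert i Sminus) (Finset.subset_univ _))
  generalize (∏ j ∈ Finset.univ.erase i, if γ j then a else 1 - a) = W at *
  generalize crp M lam = L at *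
  generalize crp M (restrictPart lam Sminus (Finset.subset_univ _)) = p at *
  generalize crp M (restrictPart lam (insert i Sminus) (Finset.subset_univ _)) = q at *
  have ha0 := ha.1
  have ha1 : 0 < 1 - a := by linarith [ha.2]
  simp only [if_true, Bool.false_eq_true, if_false]
  rw [div_eq_div_iff (by positivity) (by positivity)]
  field_simp
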